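/- (Upper bound, probabilistic form) Let r > 0, L > 0, 0 < α < 1/(2 log 2), and let σ_k² = ((2k+1)/2) · 4^{−k} · Σ_{j=0}^{⌊k/2⌋} (C(k,j) · C(2k−2j, k))². There exist constants C > 0 and ε₀ ∈ (0,1) (depending only on r, L, α) such that for every ε ∈ (0, ε₀), setting N = ⌊α log(1/ε)⌋ and defining the estimator f̂ : ℝ^ℕ → ℓ²(ℕ) by f̂(y)_k = y_k for 0 ≤ k ≤ N and f̂(y)_k = 0 for k > N, one has for every θ ∈ ℓ²(ℕ) with Σ_{k≥1} k^{2r} θ_k² ≤ L: ∫ ‖f̂(y) − θ‖²_{ℓ²} dP_θ(y) ≤ C · (log(1/ε))^{−2r}, where P_θ is the countable product probability measure on ℝ^ℕ whose k-th factor is the Gaussian measure N(θ_k, ε² σ_k²). -/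

import Mathlib

open MeasureTheory ProbabilityTheory Finset ENNReal

/-- `σ_k²`, the sum of the squared coefficients of the normalized Legendre polynomial of
degree `k`: `σ_k² = ((2k+1)/2) · 4^(−k) · Σ_{j=0}^{⌊k/2⌋} (C(k,j) · C(2k−2j, k))²`. -/
noncomputable def sigmaSq (k : ℕ) : ℝ :=
  ((2 * k + 1 : ℝ) / 2) / 4 ^ k *
    ∑ j ∈ Finset.range (k / 2 + 1),
      ((k.choose j : ℝ) * ((2 * k - 2 * j).choose k : ℝ)) ^ 2

lemma sigmaSq_nonneg (k : ℕ) : 0 ≤ sigmaSq k := by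
  unfold sigmaSq
  positivity

lemma sigmaSq_le (k : ℕ) : sigmaSq k ≤ ((k : ℝ) + 1) ^ 2 * 16 ^ k := by
  unfold sigmaSq
  have hterm : ∀ j ∈ Finset.range (k / 2 + 1),
      ((k.choose j : ℝ) * ((2 * k - 2 * j).choose k : ℝ)) ^ 2 ≤ 64 ^ k := by
    intro j _
    have h1 : (k.choose j : ℝ) ≤ 2 ^ k := by exact_mod_cast Nat.choose_le_two_pow k j
    have h2 : ((2 * k - 2 * j).choose k : ℝ) ≤ 4 ^ k := by
      have h : (2 * k - 2 * j).choose k ≤ 4 ^ k :=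
        calc (2 * k - 2 * j).choose k ≤ 2 ^ (2 * k - 2 * j) := Nat.choose_le_two_pow _ _
          _ ≤ 2 ^ (2 * k) := Nat.pow_le_pow_right (by norm_num) (Nat.sub_le _ _)
          _ = 4 ^ k := by rw [pow_mul]; norm_num
      exact_mod_cast h
    calc ((k.choose j : ℝ) * ((2 * k - 2 * j).choose k : ℝ)) ^ 2
        ≤ (2 ^ k * 4 ^ k) ^ 2 := by gcongr
      _ = 64 ^ k := by rw [← mul_pow, ← pow_mul, mul_comm k 2, pow_mul]; norm_num
  have hsum := Finset.sum_le_card_nsmul _ _ _ hterm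
  rw [Finset.card_range, nsmul_eq_mul] at hsum
  have hcard : (((k / 2 + 1 : ℕ)) : ℝ) ≤ k + 1 := by
    exact_mod_cast Nat.succ_le_succ (Nat.div_le_self k 2)
  have h64 : (64 : ℝ) ^ k = 4 ^ k * 16 ^ k := by rw [← mul_pow]; norm_num
  calc _ ≤ ((k : ℝ) + 1) / 4 ^ k * (((k : ℝ) + 1) * 64 ^ k) := by
        refine mul_le_mul ?_ (hsum.trans (by gcongr)) (by positivity) (by positivity)
        gcongr
        linarith
    _ = ((k : ℝ) + 1) ^ 2 * 16 ^ k := by rw [h64]; field_simp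

lemma lintegral_sub_sq_gaussianReal (m : ℝ) (v : NNReal) :
    ∫⁻ x, ENNReal.ofReal ((x - m) ^ 2) ∂(gaussianReal m v) = v := by
  have h := (memLp_id_gaussianReal (μ := m) (v := v) 2).ofReal_variance_eq
  rw [variance_id_gaussianReal, evariance] at h
  simp only [id, integral_id_gaussianReal, ENNReal.ofReal_coe_nnreal] at h
  rw [h]
  refine lintegral_congr fun x => ?_
  rw [← ofReal_norm, ← ENNReal.ofReal_pow (norm_nonneg _), Real.norm_eq_abs, sq_abs]

/-- The one-dimensional marginals of a projective limit of finite products. -/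
lemma IsProjectiveLimit.measurePreserving_eval {ι : Type*} {X : ι → Type*}
    [∀ i, MeasurableSpace (X i)] {μ : Measure (∀ i, X i)} {ν : ∀ i, Measure (X i)}
    [∀ i, IsProbabilityMeasure (ν i)]
    (h : IsProjectiveLimit μ (fun J : Finset ι => Measure.pi fun j : J => ν j)) (i : ι) :
    MeasurePreserving (fun y => y i) μ (ν i) := by
  have h1 : MeasurePreserving (({i} : Finset ι).restrict) μ
      (Measure.pi fun j : ({i} : Finset ι) => ν j) := ⟨by fun_prop, h {i}⟩
  exact (MeasureTheory.measurePreserving_eval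
    (fun j : ({i} : Finset ι) => ν j) ⟨i, Finset.mem_singleton_self i⟩).comp h1

lemma lp_two_norm_sq_eq_tsum (x : lp (fun _ : ℕ => ℝ) 2) : ‖x‖ ^ 2 = ∑' k, x k ^ 2 := by
  simpa using lp.norm_rpow_eq_tsum (p := 2) (by norm_num) x

lemma lp_two_summable_sq (x : lp (fun _ : ℕ => ℝ) 2) : Summable fun k => x k ^ 2 := by
  simpa using (lp.memℓp x).summable (p := 2) (by norm_num)

/-- Squared error of a truncation: error on the kept coordinates plus the discarded tail. -/
lemma norm_sq_truncation_sub (N : ℕ) (y : ℕ → ℝ) (f θ : lp (fun _ : ℕ => ℝ) 2)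
    (hf : ∀ k, f k = if k ≤ N then y k else 0) :
    ‖f - θ‖ ^ 2 = ∑ k ∈ Finset.range (N + 1), (y k - θ k) ^ 2 + ∑' k, θ (k + (N + 1)) ^ 2 := by
  rw [lp_two_norm_sq_eq_tsum, ← (lp_two_summable_sq (f - θ)).sum_add_tsum_nat_add (N + 1)]
  congr 1
  · refine Finset.sum_congr rfl fun k hk => ?_
    have : k ≤ N := Nat.lt_succ_iff.mp (Finset.mem_range.mp hk)
    simp [hf, this]
  · refine tsum_congr fun k => ?_
    have : ¬ (k + (N + 1) ≤ N) := by omega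
    simp [hf, this]

/-- Tail bound over a Sobolev-type ellipsoid. -/
lemma tsum_tail_sq_le {r L : ℝ} (hr : 0 < r) {θ : lp (fun _ : ℕ => ℝ) 2}
    (hs : Summable fun k : ℕ => (k : ℝ) ^ (2 * r) * θ k ^ 2)
    (hL : ∑' k : ℕ, (k : ℝ) ^ (2 * r) * θ k ^ 2 ≤ L) {N : ℕ} {t : ℝ} (ht : 0 < t)
    (htN : t ≤ N) :
    ∑' k, θ (k + N) ^ 2 ≤ L * t ^ (-(2 * r)) := by
  have hθ : Summable fun k => θ (k + N) ^ 2 :=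
    (summable_nat_add_iff (f := fun k => θ k ^ 2) N).2 (lp_two_summable_sq θ)
  have hs' : Summable fun k : ℕ => ((k + N : ℕ) : ℝ) ^ (2 * r) * θ (k + N) ^ 2 :=
    (summable_nat_add_iff (f := fun k : ℕ => (k : ℝ) ^ (2 * r) * θ k ^ 2) N).2 hs
  have h1 : t ^ (2 * r) * ∑' k, θ (k + N) ^ 2 ≤ L := by
    rw [← tsum_mul_left]
    calc _ ≤ ∑' k : ℕ, ((k + N : ℕ) : ℝ) ^ (2 * r) * θ (k + N) ^ 2 := by
          refine (hθ.mul_left _).tsum_le_tsum (fun k => ?_) hs'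
          gcongr
          push_cast
          linarith [(Nat.cast_nonneg k : (0 : ℝ) ≤ k)]
      _ ≤ ∑' k : ℕ, (k : ℝ) ^ (2 * r) * θ k ^ 2 := by
          rw [← hs.sum_add_tsum_nat_add N]
          exact le_add_of_nonneg_left (Finset.sum_nonneg fun k _ => by positivity)
      _ ≤ L := hL
  rw [Real.rpow_neg ht.le, ← div_eq_mul_inv, le_div_iff₀ (by positivity), mul_comm]
  exact h1

lemma lintegral_truncation_risk {v : ℕ → NNReal} {μ : Measure (ℕ → ℝ)} [IsProbabilityMeasure μ]
    {N : ℕ} {fhat : (ℕ → ℝ) → lp (fun _ : ℕ => ℝ) 2} {θ : lp (fun _ : ℕ => ℝ) 2}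
    (hμ : IsProjectiveLimit μ
      (fun J : Finset ℕ => Measure.pi fun j : J => gaussianReal (θ j) (v j)))
    (hf : ∀ (y : ℕ → ℝ) (k : ℕ), fhat y k = if k ≤ N then y k else 0) :
    ∫⁻ y, (‖fhat y - θ‖₊ : ℝ≥0∞) ^ 2 ∂μ =
      ENNReal.ofReal (∑ k ∈ Finset.range (N + 1), (v k : ℝ) + ∑' k, θ (k + (N + 1)) ^ 2) := by
  have hpt : ∀ y, (‖fhat y - θ‖₊ : ℝ≥0∞) ^ 2 =
      ∑ k ∈ Finset.range (N + 1), ENNReal.ofReal ((y k - θ k) ^ 2) +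
        ENNReal.ofReal (∑' k, θ (k + (N + 1)) ^ 2) := by
    intro y
    rw [← ENNReal.ofReal_sum_of_nonneg (fun k _ => sq_nonneg _),
      ← ENNReal.ofReal_add (Finset.sum_nonneg fun k _ => sq_nonneg _)
        (tsum_nonneg fun k => sq_nonneg _), ← norm_sq_truncation_sub N y _ θ (hf y),
      ENNReal.ofReal_pow (norm_nonneg _), ofReal_norm]
    rfl
  have hcoord : ∀ k, ∫⁻ y, ENNReal.ofReal ((y k - θ k) ^ 2) ∂μ = v k := by
    intro k
    rw [← lintegral_sub_sq_gaussianReal (θ k) (v k)]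
    exact (IsProjectiveLimit.measurePreserving_eval
      (ν := fun k => gaussianReal (θ k) (v k)) hμ k).lintegral_comp
      (f := fun x => ENNReal.ofReal ((x - θ k) ^ 2)) (by fun_prop)
  simp_rw [hpt]
  rw [lintegral_add_right _ measurable_const, lintegral_finsetSum _ (fun k _ => by fun_prop),
    lintegral_const, measure_univ, mul_one, ENNReal.ofReal_add
      (Finset.sum_nonneg fun k _ => (v k).coe_nonneg) (tsum_nonneg fun k => sq_nonneg _),
    ENNReal.ofReal_sum_of_nonneg (fun k _ => (v k).coe_nonneg)]
  simp [hcoord]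

lemma sum_sigmaSq_le (N : ℕ) :
    ∑ k ∈ Finset.range (N + 1), sigmaSq k ≤ ((N : ℝ) + 1) ^ 3 * 16 ^ N := by
  have h : ∀ k ∈ Finset.range (N + 1), sigmaSq k ≤ ((N : ℝ) + 1) ^ 2 * 16 ^ N := by
    intro k hk
    have hk' : k ≤ N := Nat.lt_succ_iff.mp (Finset.mem_range.mp hk)
    refine (sigmaSq_le k).trans ?_
    gcongr
    norm_num
  refine (Finset.sum_le_card_nsmul _ _ _ h).trans_eq ?_
  rw [Finset.card_range, nsmul_eq_mul]
  push_cast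
  ring

/-- With cut-off `⌊α ℓ⌋`, where `ℓ = log (1/ε)`, the total variance is exponentially small in `ℓ`
up to a polynomial factor. -/
lemma exp_mul_sum_sigmaSq_le {α l : ℝ} (hα : 0 ≤ α) (hl : 0 ≤ l) :
    Real.exp (-l) ^ 2 * ∑ k ∈ Finset.range (⌊α * l⌋₊ + 1), sigmaSq k ≤
      (α * l + 1) ^ 3 * Real.exp (-(2 - 4 * α * Real.log 2) * l) := by
  have hN : (⌊α * l⌋₊ : ℝ) ≤ α * l := Nat.floor_le (by positivity)
  have h16 : (16 : ℝ) ^ ⌊α * l⌋₊ ≤ Real.exp (4 * Real.log 2 * (α * l)) := by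
    have h : (16 : ℝ) = Real.exp (4 * Real.log 2) := by
      rw [mul_comm, Real.exp_mul, Real.exp_log two_pos]; norm_num
    rw [h, ← Real.exp_nat_mul, Real.exp_le_exp, mul_comm]
    gcongr
  calc _ ≤ Real.exp (-l) ^ 2 * ((α * l + 1) ^ 3 * Real.exp (4 * Real.log 2 * (α * l))) := by
        gcongr
        exact (sum_sigmaSq_le _).trans (by gcongr)
    _ = (α * l + 1) ^ 3 * (Real.exp (-l) ^ 2 * Real.exp (4 * Real.log 2 * (α * l))) := by ring
    _ = _ := by
        rw [← Real.exp_nat_mul, ← Real.exp_add]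
        congr 2
        push_cast
        ring

lemma eventually_poly_mul_exp_le_rpow {α s c : ℝ} (hα : 0 ≤ α) (hc : 0 < c) :
    ∀ᶠ l : ℝ in Filter.atTop, (α * l + 1) ^ 3 * Real.exp (-c * l) ≤ l ^ (-s) := by
  have h := (tendsto_rpow_mul_exp_neg_mul_atTop_nhds_zero (s + 3) c hc).const_mul ((α + 1) ^ 3)
  rw [mul_zero] at h
  filter_upwards [h.eventually_le_const one_pos, Filter.eventually_ge_atTop 1] with l hl h1
  have hl0 : 0 < l := by linarith
  rw [Real.rpow_neg hl0.le, ← one_div, le_div_iff₀ (by positivity)]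
  calc (α * l + 1) ^ 3 * Real.exp (-c * l) * l ^ s
      ≤ ((α + 1) * l) ^ 3 * Real.exp (-c * l) * l ^ s := by
        gcongr
        nlinarith
    _ = (α + 1) ^ 3 * (l ^ (s + 3) * Real.exp (-c * l)) := by
        rw [Real.rpow_add hl0, mul_pow]
        norm_cast
        ring
    _ ≤ 1 := hl

/-- Upper bound, probabilistic form: for `r > 0`, `L > 0`, `0 < α < 1/(2 log 2)` there are
`C > 0` and `ε₀ ∈ (0,1)` such that for every `ε ∈ (0, ε₀)`, with `N = ⌊α log(1/ε)⌋`, the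
truncation estimator `f̂(y)_k = y_k` for `k ≤ N`, `f̂(y)_k = 0` for `k > N`, satisfies, for
every `θ ∈ ℓ²` with `Σ_{k≥1} k^(2r) θ_k² ≤ L`,
`∫ ‖f̂(y) − θ‖²_{ℓ²} dP_θ(y) ≤ C (log(1/ε))^(−2r)`, where `P_θ` is the countable product
of the Gaussian measures `N(θ_k, ε²σ_k²)`. -/
theorem upper_bound_probabilistic (r L α : ℝ) (hr : 0 < r) (hL : 0 < L)
    (hα : 0 < α) (hα' : α < 1 / (2 * Real.log 2)) :
    ∃ C : ℝ, 0 < C ∧ ∃ ε₀ ∈ Set.Ioo (0 : ℝ) 1, ∀ ε ∈ Set.Ioo (0 : ℝ) ε₀,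
      ∀ P : lp (fun _ : ℕ => ℝ) 2 → Measure (ℕ → ℝ),
        (∀ θ, IsProbabilityMeasure (P θ)) →
        (∀ θ, IsProjectiveLimit (P θ)
          (fun J : Finset ℕ => Measure.pi fun j : J =>
            gaussianReal (θ j) (Real.toNNReal (ε ^ 2 * sigmaSq j)))) →
        ∀ fhat : (ℕ → ℝ) → lp (fun _ : ℕ => ℝ) 2,
          (∀ (y : ℕ → ℝ) (k : ℕ),
            fhat y k = if k ≤ ⌊α * Real.log (1 / ε)⌋₊ then y k else 0) →
          ∀ θ : lp (fun _ : ℕ => ℝ) 2,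
            (Summable fun k : ℕ => (k : ℝ) ^ (2 * r) * θ k ^ 2) →
            (∑' k : ℕ, (k : ℝ) ^ (2 * r) * θ k ^ 2 ≤ L) →
            ∫⁻ y, (‖fhat y - θ‖₊ : ℝ≥0∞) ^ 2 ∂(P θ) ≤
              ENNReal.ofReal (C * Real.log (1 / ε) ^ (-(2 * r))) := by
  have hc : 0 < 2 - 4 * α * Real.log 2 := by
    have := Real.log_pos one_lt_two
    rw [lt_div_iff₀ (by positivity)] at hα'
    linarith
  obtain ⟨l₀, hl₀⟩ := Filter.eventually_atTop.1
    (eventually_poly_mul_exp_le_rpow (s := 2 * r) hα.le hc)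
  have hM : 0 < max l₀ 1 := by positivity
  refine ⟨1 + L * α ^ (-(2 * r)), by positivity, Real.exp (-max l₀ 1),
    ⟨Real.exp_pos _, by rw [Real.exp_lt_one_iff]; linarith⟩, ?_⟩
  rintro ε ⟨hε, hε'⟩ P hP hproj fhat hfhat θ hs hθ
  have := hP θ
  have hl : max l₀ 1 < Real.log (1 / ε) := by
    rw [one_div, Real.log_inv, lt_neg]
    exact (Real.log_lt_iff_lt_exp hε).2 hε'
  have hεl : ε = Real.exp (-Real.log (1 / ε)) := by
    rw [one_div, Real.log_inv, neg_neg, Real.exp_log hε]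
  set l := Real.log (1 / ε)
  have hlpos : 0 < l := hM.trans hl
  rw [lintegral_truncation_risk
    (v := fun k => Real.toNNReal (ε ^ 2 * sigmaSq k)) (hproj θ) hfhat]
  refine ENNReal.ofReal_le_ofReal ?_
  have hvar : ∑ k ∈ Finset.range (⌊α * l⌋₊ + 1), (Real.toNNReal (ε ^ 2 * sigmaSq k) : ℝ) ≤
      l ^ (-(2 * r)) := by
    simp_rw [Real.coe_toNNReal _ (mul_nonneg (sq_nonneg ε) (sigmaSq_nonneg _))]
    rw [← Finset.mul_sum]
    nth_rewrite 1 [hεl]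
    exact (exp_mul_sum_sigmaSq_le hα.le hlpos.le).trans (hl₀ l ((le_max_left _ _).trans hl.le))
  have hbias := tsum_tail_sq_le hr hs hθ (N := ⌊α * l⌋₊ + 1) (t := α * l) (by positivity)
    (by push_cast; exact (Nat.lt_floor_add_one _).le)
  rw [Real.mul_rpow hα.le hlpos.le] at hbias
  linarith
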